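/- arXiv:1404.2471 — 4 statements merged into one kernel-verified Lean document; each statement's English description precedes it below -/
import Mathlib

section
/- Let f : 𝔽₂ⁿ → 𝔽₂ be a Boolean function with 0/1 integer lift F : 𝔽₂ⁿ → ℚ. Define c : 𝔽₂^{n+1} → ℚ by c(0) = Σ_{u ∈ 𝔽₂ⁿ} F(u), and for v = (v₀, ṽ) ≠ 0 (with v₀ ∈ 𝔽₂ and ṽ ∈ 𝔽₂ⁿ) by c(v) = (−2)^{w(v)} · Σ_{u ∈ 𝔽₂ⁿ, ṽ ⪯ u} (F(u) − 1/2), where w(v) is the Hamming weight of v. Then for every (a₀, a₁, …, aₙ) ∈ {0,1}^{n+1} ⊂ ℚ^{n+1}, the evaluation Σ_{v ∈ 𝔽₂^{n+1}} c(v) · Π_{i=0}^{n} aᵢ^{vᵢ} equals the Hamming distance between f and the affine Boolean function x ↦ ā₀ + ā₁x₁ + ⋯ + āₙxₙ, where āᵢ ∈ 𝔽₂ is the reduction of aᵢ. (The evaluations of the nonlinearity polynomial are exactly the distances of f from all affine functions, and its coefficients are given by the stated formulas.) -/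
open Finset

/-- Hamming weight of a vector over 𝔽₂. -/
def wt {m : ℕ} (v : Fin m → ZMod 2) : ℕ :=
  (univ.filter (fun i : Fin m => v i = 1)).card

/-- The sign `(-1)^z` of an element `z` of 𝔽₂. -/
def sign2 (z : ZMod 2) : ℚ := if z = 1 then -1 else 1

lemma sign2_add (y z : ZMod 2) : sign2 (y + z) = sign2 y * sign2 z := by
  have h : ∀ y z : ZMod 2, (y + z = 1 ↔ ¬(y = 1 ↔ z = 1)) := by decide
  simp only [sign2, h]
  by_cases hy : y = 1 <;> by_cases hz : z = 1 <;> simp [hy, hz]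

lemma sign2_sum {ι : Type*} (s : Finset ι) (z : ι → ZMod 2) :
    sign2 (∑ i ∈ s, z i) = ∏ i ∈ s, sign2 (z i) := by
  classical
  induction s using Finset.induction_on with
  | empty => simp [sign2]
  | insert i s hi ih => rw [sum_insert hi, prod_insert hi, sign2_add, ih]

lemma ite_ne_eq_sign2 (y z : ZMod 2) :
    (if y ≠ z then 1 else 0 : ℚ) = 1 / 2 + ((if y = 1 then 1 else 0) - 1 / 2) * sign2 z := by
  have h : ∀ y z : ZMod 2, (y = z ↔ (y = 1 ↔ z = 1)) := by decide
  simp only [sign2, ne_eq, h y z]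
  by_cases hy : y = 1 <;> by_cases hz : z = 1 <;> simp [hy, hz] <;> norm_num

lemma pow_wt {m : ℕ} (r : ℚ) (v : Fin m → ZMod 2) :
    r ^ wt v = ∏ i, if v i = 1 then r else 1 := by
  rw [wt, ← prod_const, prod_filter]

lemma sum_prod_ite {m : ℕ} (r : Fin m → ℚ) :
    (∑ v : Fin m → ZMod 2, ∏ i, if v i = 1 then r i else 1) = ∏ i, (1 + r i) := by
  rw [← Fintype.prod_sum (fun i (z : ZMod 2) => if z = 1 then r i else 1)]
  refine prod_congr rfl fun i _ => ?_
  rw [show (univ : Finset (ZMod 2)) = {0, 1} by decide, sum_pair zero_ne_one]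
  simp

/-- Summing the monomials supported below `u` gives the sign of the affine function at `u`. -/
lemma sum_monomials_eq_sign2 {n : ℕ} (a : Fin (n + 1) → ℚ) (ha : ∀ i, a i = 0 ∨ a i = 1)
    (abar : Fin (n + 1) → ZMod 2) (habar : ∀ i, abar i = if a i = 1 then 1 else 0)
    (u : Fin n → ZMod 2) :
    (∑ v : Fin (n + 1) → ZMod 2, if ∀ i, v i.succ = 1 → u i = 1 then
        (-2 : ℚ) ^ wt v * ∏ i, a i ^ (if v i = 1 then 1 else 0 : ℕ) else 0)
      = sign2 (abar 0 + ∑ i : Fin n, abar i.succ * u i) := by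
  have hterm (v : Fin (n + 1) → ZMod 2) : (if ∀ i, v i.succ = 1 → u i = 1 then
        (-2 : ℚ) ^ wt v * ∏ i, a i ^ (if v i = 1 then 1 else 0 : ℕ) else 0)
      = ∏ i, if v i = 1 then
          (Fin.cons (-2 * a 0) (fun j => if u j = 1 then -2 * a j.succ else 0) :
            Fin (n + 1) → ℚ) i else 1 := by
    split_ifs with h
    · rw [pow_wt, ← prod_mul_distrib]
      refine prod_congr rfl fun i _ => ?_
      refine Fin.cases ?_ (fun j => ?_) i
      · by_cases hv : v 0 = 1 <;> simp [hv]
      · by_cases hv : v j.succ = 1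
        · simp [hv, h j hv]
        · simp [hv]
    · push Not at h
      obtain ⟨j, hv, hu⟩ := h
      exact (prod_eq_zero (mem_univ j.succ) (by simp [hv, hu])).symm
  rw [sum_congr rfl fun v _ => hterm v, sum_prod_ite, Fin.prod_univ_succ, sign2_add, sign2_sum]
  have hz : ∀ z : ZMod 2, z = 0 ∨ z = 1 := by decide
  congr 1
  · rcases ha 0 with h | h <;> simp [habar, h, sign2]
    norm_num
  · refine prod_congr rfl fun j _ => ?_
    rcases ha j.succ with h | h <;> rcases hz (u j) with hu | hu <;>
      simp [habar, h, hu, sign2]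
    norm_num

/-- The evaluation of the nonlinearity polynomial of a Boolean function `f` at any
point `a ∈ {0,1}^{n+1} ⊂ ℚ^{n+1}` equals the Hamming distance between `f` and the
affine Boolean function `x ↦ ā₀ + ā₁ x₁ + ⋯ + āₙ xₙ`, where `āᵢ` is the reduction
of `aᵢ` to 𝔽₂. -/
theorem nlp_eval_eq_dist (n : ℕ) (f : (Fin n → ZMod 2) → ZMod 2)
    (F : (Fin n → ZMod 2) → ℚ) (hF : ∀ x, F x = if f x = 1 then 1 else 0)
    (c : (Fin (n + 1) → ZMod 2) → ℚ)
    (hc0 : c 0 = ∑ u : Fin n → ZMod 2, F u)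
    (hcv : ∀ v : Fin (n + 1) → ZMod 2, v ≠ 0 →
      c v = (-2 : ℚ) ^ wt v *
        ∑ u ∈ univ.filter (fun u : Fin n → ZMod 2 => ∀ i, v i.succ = 1 → u i = 1),
          (F u - 1 / 2))
    (a : Fin (n + 1) → ℚ) (ha : ∀ i, a i = 0 ∨ a i = 1)
    (abar : Fin (n + 1) → ZMod 2) (habar : ∀ i, abar i = if a i = 1 then 1 else 0) :
    (∑ v : Fin (n + 1) → ZMod 2,
        c v * ∏ i : Fin (n + 1), a i ^ (if v i = 1 then 1 else 0 : ℕ))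
      = ((univ.filter (fun x : Fin n → ZMod 2 =>
            f x ≠ abar 0 + ∑ i : Fin n, abar i.succ * x i)).card : ℚ) := by
  have hc (v : Fin (n + 1) → ZMod 2) : c v = (if v = 0 then ∑ _u : Fin n → ZMod 2, 1 / 2 else 0) +
      (-2 : ℚ) ^ wt v *
        ∑ u ∈ univ.filter (fun u : Fin n → ZMod 2 => ∀ i, v i.succ = 1 → u i = 1),
          (F u - 1 / 2) := by
    by_cases hv : v = 0
    · subst hv
      simp only [hc0, pow_wt, Pi.zero_apply, zero_ne_one, false_imp_iff, implies_true,
        filter_true, if_true, if_false, prod_const_one, one_mul, ← sum_add_distrib]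
      simp
    · simp [hv, hcv v hv]
  have hmain : (∑ v : Fin (n + 1) → ZMod 2, ((-2 : ℚ) ^ wt v *
        ∑ u ∈ univ.filter (fun u : Fin n → ZMod 2 => ∀ i, v i.succ = 1 → u i = 1),
          (F u - 1 / 2)) * ∏ i, a i ^ (if v i = 1 then 1 else 0 : ℕ))
      = ∑ u, (F u - 1 / 2) * sign2 (abar 0 + ∑ i : Fin n, abar i.succ * u i) := by
    simp only [← sum_monomials_eq_sign2 a ha abar habar, sum_filter, mul_sum, sum_mul]
    rw [sum_comm]
    refine sum_congr rfl fun u _ => sum_congr rfl fun v _ => ?_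
    split_ifs <;> ring
  simp only [hc, add_mul, sum_add_distrib, hmain, ite_mul, zero_mul, sum_ite_eq', mem_univ,
    if_true, Pi.zero_apply, zero_ne_one, if_false, pow_zero, prod_const_one, mul_one]
  rw [← sum_add_distrib, card_filter, Nat.cast_sum]
  refine sum_congr rfl fun u _ => ?_
  rw [hF, Nat.cast_ite, Nat.cast_one, Nat.cast_zero, ite_ne_eq_sign2]
end

section
/- Let f : 𝔽₂ⁿ → 𝔽₂ be a Boolean function, with nonlinearity polynomial coefficients c : 𝔽₂^{n+1} → ℚ defined by c(0) = Σ_{u} F(u) and c(v) = (−2)^{w(v)} · Σ_{ṽ ⪯ u} (F(u) − 1/2) for v = (v₀, ṽ) ≠ 0, where F is the 0/1 integer lift of f. Then the nonlinearity N(f) = min over all affine Boolean functions α of d(f, α) satisfies N(f) = min over a ∈ {0,1}^{n+1} ⊂ ℚ^{n+1} of Σ_{v ∈ 𝔽₂^{n+1}} c(v) · Π_{i=0}^{n} aᵢ^{vᵢ}. -/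
open Finset

/-- The sign `(-1)^⟨b, y⟩` of an inner product over 𝔽₂ factors over the coordinates. -/
theorem prod_one_sub_two_mul_eq_sign {ι : Type*} (s : Finset ι) (b y : ι → ZMod 2) :
    ∏ i ∈ s, (1 + if b i = 1 ∧ y i = 1 then (-2 : ℚ) else 0) =
      if ∑ i ∈ s, b i * y i = 1 then -1 else 1 := by
  classical
  induction s using Finset.induction_on with
  | empty => simp
  | insert j s hj ih =>
    rw [prod_insert hj, sum_insert hj, ih]
    generalize ∑ i ∈ s, b i * y i = t
    generalize b j = p
    generalize y j = q
    have h01 : ∀ x : ZMod 2, x = 0 ∨ x = 1 := by decide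
    have h2 : (2 : ZMod 2) ≠ 1 := by decide
    obtain rfl | rfl := h01 t <;> obtain rfl | rfl := h01 p <;> obtain rfl | rfl := h01 q <;>
      norm_num [h2]

/-- Expansion of a product of binomials over the vectors of `𝔽₂^ι`. -/
theorem sum_prod_ite_eq_prod_one_add {ι R : Type*} [Fintype ι] [DecidableEq ι] [CommSemiring R]
    (g : ι → R) :
    ∑ v : ι → ZMod 2, ∏ i, (if v i = 1 then g i else 1) = ∏ i, (1 + g i) := by
  have h (i : ι) : 1 + g i = ∑ x : ZMod 2, if x = 1 then g i else 1 := by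
    rw [show (univ : Finset (ZMod 2)) = {0, 1} from rfl, sum_pair (by decide)]
    simp
  simp_rw [h, prod_univ_sum, Fintype.piFinset_univ]

theorem pow_wt_eq_prod {m : ℕ} {R : Type*} [CommMonoid R] (r : R) (v : Fin m → ZMod 2) :
    r ^ wt v = ∏ i, if v i = 1 then r else 1 := by
  rw [wt, ← prod_const, prod_filter]

/-- The indicator of `x ≠ y` over 𝔽₂ in terms of the indicator of `x` and the sign of `y`. -/
theorem indicator_ne_eq_half_add_sign_mul (x y : ZMod 2) :
    (if x ≠ y then (1 : ℚ) else 0) =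
      1 / 2 + (if y = 1 then -1 else 1) * ((if x = 1 then 1 else 0) - 1 / 2) := by
  have h01 : ∀ x : ZMod 2, x = 0 ∨ x = 1 := by decide
  obtain rfl | rfl := h01 x <;> obtain rfl | rfl := h01 y <;> norm_num

/-- Evaluating the nonlinearity polynomial at the point `b` gives the distance from `f` to the
affine function with coefficients `b`. -/
theorem card_ne_affine_eq_nlp_eval (n : ℕ) (f : (Fin n → ZMod 2) → ZMod 2)
    (F : (Fin n → ZMod 2) → ℚ) (hF : ∀ x, F x = if f x = 1 then 1 else 0)
    (c : (Fin (n + 1) → ZMod 2) → ℚ)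
    (hc0 : c 0 = ∑ u : Fin n → ZMod 2, F u)
    (hcv : ∀ v : Fin (n + 1) → ZMod 2, v ≠ 0 →
      c v = (-2 : ℚ) ^ wt v *
        ∑ u ∈ univ.filter (fun u : Fin n → ZMod 2 => ∀ i, v i.succ = 1 → u i = 1),
          (F u - 1 / 2)) (b : Fin (n + 1) → ZMod 2) (a : Fin (n + 1) → Bool)
    (hab : ∀ i, a i = true ↔ b i = 1) :
    ((univ.filter (fun x : Fin n → ZMod 2 =>
          f x ≠ b 0 + ∑ i : Fin n, b i.succ * x i)).card : ℚ) =
      ∑ v : Fin (n + 1) → ZMod 2,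
            c v * ∏ i : Fin (n + 1),
              (if a i then (1 : ℚ) else 0) ^ (if v i = 1 then 1 else 0 : ℕ) := by
  have hc (v : Fin (n + 1) → ZMod 2) : c v = (if v = 0 then ∑ _u : Fin n → ZMod 2, 1 / 2 else 0) +
      ∑ u : Fin n → ZMod 2, (F u - 1 / 2) *
        ∏ i, if v i = 1 then (if (Fin.cons 1 u : Fin (n + 1) → ZMod 2) i = 1 then -2 else 0)
          else 1 := by
    have hmono (u : Fin n → ZMod 2) :
        (∏ i, if v i = 1 then
            (if (Fin.cons 1 u : Fin (n + 1) → ZMod 2) i = 1 then (-2 : ℚ) else 0) else 1) =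
          if ∀ i, v i.succ = 1 → u i = 1 then (-2) ^ wt v else 0 := by
      rw [pow_wt_eq_prod]
      split_ifs with h
      · refine prod_congr rfl fun i _ => ?_
        refine Fin.cases ?_ (fun j => ?_) i
        · simp
        · by_cases hj : v j.succ = 1 <;> simp [hj, h j]
      · push Not at h
        obtain ⟨j, hj, hu⟩ := h
        exact prod_eq_zero (mem_univ j.succ) (by simp [hj, hu])
    simp_rw [hmono]
    by_cases hv : v = 0
    · subst hv
      rw [hc0, if_pos rfl, ← sum_add_distrib]
      simp [wt]
    · rw [hcv v hv, if_neg hv, zero_add, mul_sum, sum_filter]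
      refine sum_congr rfl fun u _ => ?_
      split_ifs <;> ring
  have hzero : (∏ i : Fin (n + 1), (if a i then (1 : ℚ) else 0) ^
      (if (0 : Fin (n + 1) → ZMod 2) i = 1 then 1 else 0 : ℕ)) = 1 := by simp
  have haff (u : Fin n → ZMod 2) : b 0 + ∑ i : Fin n, b i.succ * u i =
      ∑ i, b i * (Fin.cons 1 u : Fin (n + 1) → ZMod 2) i := by
    simp [Fin.sum_univ_succ]
  simp_rw [hc, add_mul, sum_add_distrib, ite_mul, zero_mul, sum_ite_eq', mem_univ, if_true, hzero,
    mul_one, sum_mul]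
  rw [sum_comm, ← sum_add_distrib, card_filter, Nat.cast_sum]
  refine sum_congr rfl fun u _ => ?_
  simp_rw [mul_assoc, ← mul_sum, ← prod_mul_distrib]
  rw [haff, Nat.cast_ite, Nat.cast_one, Nat.cast_zero, indicator_ne_eq_half_add_sign_mul,
    ← prod_one_sub_two_mul_eq_sign, ← sum_prod_ite_eq_prod_one_add, hF u, mul_comm]
  congr 2
  refine sum_congr rfl fun v _ => prod_congr rfl fun i _ => ?_
  by_cases hv : v i = 1 <;> by_cases hb : b i = 1 <;> simp [hv, hb, hab]

/-- Two minima agree when each index on either side has a partner of equal value. -/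
theorem inf'_univ_eq_inf'_univ_of_maps {α β γ : Type*} [Fintype α] [Nonempty α] [Fintype β]
    [Nonempty β] [SemilatticeInf γ] {g : α → γ} {h : β → γ} (e : α → β) (e' : β → α)
    (he : ∀ a, g a = h (e a)) (he' : ∀ b, h b = g (e' b)) :
    univ.inf' univ_nonempty g = univ.inf' univ_nonempty h :=
  le_antisymm (le_inf' _ _ fun b _ => (inf'_le g (mem_univ (e' b))).trans_eq (he' b).symm)
    (le_inf' _ _ fun a _ => (inf'_le h (mem_univ (e a))).trans_eq (he a).symm)

/-- The nonlinearity of `f` (the minimum Hamming distance from `f` to an affine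
Boolean function) equals the minimum of the evaluations of the nonlinearity
polynomial over all points of `{0,1}^{n+1} ⊂ ℚ^{n+1}`. -/
theorem nonlinearity_eq_min_nlp_eval (n : ℕ) (f : (Fin n → ZMod 2) → ZMod 2)
    (F : (Fin n → ZMod 2) → ℚ) (hF : ∀ x, F x = if f x = 1 then 1 else 0)
    (c : (Fin (n + 1) → ZMod 2) → ℚ)
    (hc0 : c 0 = ∑ u : Fin n → ZMod 2, F u)
    (hcv : ∀ v : Fin (n + 1) → ZMod 2, v ≠ 0 →
      c v = (-2 : ℚ) ^ wt v *
        ∑ u ∈ univ.filter (fun u : Fin n → ZMod 2 => ∀ i, v i.succ = 1 → u i = 1),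
          (F u - 1 / 2)) :
    ((univ.inf' univ_nonempty (fun b : Fin (n + 1) → ZMod 2 =>
        (univ.filter (fun x : Fin n → ZMod 2 =>
          f x ≠ b 0 + ∑ i : Fin n, b i.succ * x i)).card) : ℕ) : ℚ)
      = univ.inf' univ_nonempty (fun b : Fin (n + 1) → Bool =>
          ∑ v : Fin (n + 1) → ZMod 2,
            c v * ∏ i : Fin (n + 1),
              (if b i then (1 : ℚ) else 0) ^ (if v i = 1 then 1 else 0 : ℕ)) := by
  have hdist := card_ne_affine_eq_nlp_eval n f F hF c hc0 hcv
  rw [apply_inf'_eq_inf'_comp (g := (Nat.cast : ℕ → ℚ)) univ_nonempty Nat.cast_min]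
  refine inf'_univ_eq_inf'_univ_of_maps (fun b i => decide (b i = 1))
    (fun a i => if a i then 1 else 0) (fun b => ?_) (fun a => ?_)
  · rw [Function.comp_apply, hdist b (fun i => decide (b i = 1)) fun i => by simp]
  · rw [Function.comp_apply, hdist (fun i => if a i then 1 else 0) a fun i => by simp]
end

section
/- Let f : 𝔽₂ⁿ → 𝔽₂ be a Boolean function, with nonlinearity polynomial coefficients c : 𝔽₂^{n+1} → ℚ defined by c(0) = Σ_{u} F(u) and c(v) = (−2)^{w(v)} · Σ_{ṽ ⪯ u} (F(u) − 1/2) for v = (v₀, ṽ) ≠ 0, where F is the 0/1 integer lift of f. Then every coefficient c(v) is an integer and satisfies |c(v)| ≤ 2ⁿ. -/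
open Finset

lemma two_pow_wt {m : ℕ} (v : Fin m → ZMod 2) :
    2 ^ wt v = ∏ i, if v i = 1 then 2 else 1 := by
  rw [wt, prod_ite, prod_const, prod_const_one, mul_one]

lemma wt_pos {m : ℕ} {v : Fin m → ZMod 2} (hv : v ≠ 0) : 0 < wt v := by
  obtain ⟨i, hi⟩ := Function.ne_iff.mp hv
  have h1 : v i = 1 := Fin.eq_one_of_ne_zero (v i) hi
  exact card_pos.mpr ⟨i, by simp [h1]⟩

lemma card_filter_dominating {n : ℕ} (w : Fin n → ZMod 2) :
    (univ.filter (fun u : Fin n → ZMod 2 => ∀ i, w i = 1 → u i = 1)).card =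
      ∏ i, if w i = 1 then 1 else 2 := by
  have h : univ.filter (fun u : Fin n → ZMod 2 => ∀ i, w i = 1 → u i = 1) =
      Fintype.piFinset (fun i => if w i = 1 then {1} else univ) := by
    ext u
    simp only [mem_filter, mem_univ, true_and, Fintype.mem_piFinset]
    refine forall_congr' fun i => ?_
    split_ifs with hi <;> simp [hi]
  rw [h, Fintype.card_piFinset]
  refine prod_congr rfl fun i _ => ?_
  split_ifs <;> simp [ZMod.card]

lemma two_pow_wt_mul_card_filter_le {n : ℕ} (v : Fin (n + 1) → ZMod 2) :
    2 ^ wt v * (univ.filter (fun u : Fin n → ZMod 2 => ∀ i, v i.succ = 1 → u i = 1)).card ≤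
      2 ^ (n + 1) := by
  rw [card_filter_dominating (fun i => v i.succ), two_pow_wt, Fin.prod_univ_succ, mul_assoc,
    ← prod_mul_distrib]
  have h : ∀ i : Fin n,
      ((if v i.succ = 1 then 2 else 1) * if v i.succ = 1 then 1 else 2) = 2 := by
    intro i
    split_ifs <;> rfl
  rw [prod_congr rfl fun i _ => h i, prod_const, card_univ, Fintype.card_fin, pow_succ, mul_comm]
  gcongr
  split_ifs <;> norm_num

/-- Every coefficient of the nonlinearity polynomial of a Boolean function on 𝔽₂ⁿ
is an integer of absolute value at most `2ⁿ`. -/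
theorem nlp_coeff_int_and_bound (n : ℕ) (f : (Fin n → ZMod 2) → ZMod 2)
    (F : (Fin n → ZMod 2) → ℚ) (hF : ∀ x, F x = if f x = 1 then 1 else 0)
    (c : (Fin (n + 1) → ZMod 2) → ℚ)
    (hc0 : c 0 = ∑ u : Fin n → ZMod 2, F u)
    (hcv : ∀ v : Fin (n + 1) → ZMod 2, v ≠ 0 →
      c v = (-2 : ℚ) ^ wt v *
        ∑ u ∈ univ.filter (fun u : Fin n → ZMod 2 => ∀ i, v i.succ = 1 → u i = 1),
          (F u - 1 / 2)) :
    ∀ v : Fin (n + 1) → ZMod 2, (∃ m : ℤ, c v = m) ∧ |c v| ≤ 2 ^ n := by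
  intro v
  by_cases hv : v = 0
  · subst hv
    rw [hc0]
    refine ⟨⟨∑ u, if f u = 1 then 1 else 0, ?_⟩, ?_⟩
    · push_cast
      exact sum_congr rfl fun u _ => hF u
    · calc |∑ u, F u| ≤ ∑ u, |F u| := abs_sum_le_sum_abs _ _
        _ ≤ ∑ _u : Fin n → ZMod 2, (1 : ℚ) := by
          gcongr with u
          rw [hF]
          split_ifs <;> norm_num
        _ = 2 ^ n := by simp [ZMod.card]
  · rw [hcv v hv]
    have hle := two_pow_wt_mul_card_filter_le v
    generalize univ.filter (fun u : Fin n → ZMod 2 => ∀ i, v i.succ = 1 → u i = 1) = S at hle ⊢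
    constructor
    · obtain ⟨k, hk⟩ := Nat.exists_eq_succ_of_ne_zero (wt_pos hv).ne'
      refine ⟨(-2) ^ k * ∑ u ∈ S, if f u = 1 then -1 else 1, ?_⟩
      rw [hk, pow_succ, mul_assoc, mul_sum]
      push_cast
      congr 1
      refine sum_congr rfl fun u _ => ?_
      rw [hF]
      split_ifs <;> norm_num
    · have hS : |∑ u ∈ S, (F u - 1 / 2)| ≤ S.card * (1 / 2) := by
        calc |∑ u ∈ S, (F u - 1 / 2)| ≤ ∑ u ∈ S, |F u - 1 / 2| := abs_sum_le_sum_abs _ _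
          _ ≤ ∑ _u ∈ S, (1 / 2 : ℚ) := by
            gcongr with u
            rw [hF]
            split_ifs <;> norm_num [abs_of_pos, abs_of_neg]
          _ = S.card * (1 / 2) := by rw [sum_const, nsmul_eq_mul]
      have hle' : (2 : ℚ) ^ wt v * S.card ≤ 2 ^ (n + 1) := by exact_mod_cast hle
      rw [abs_mul, abs_pow, abs_neg, abs_two]
      calc (2 : ℚ) ^ wt v * |∑ u ∈ S, (F u - 1 / 2)| ≤ 2 ^ wt v * (S.card * (1 / 2)) := by gcongr
        _ ≤ 2 ^ n := by
          rw [pow_succ] at hle'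
          linarith
end

section
/- Let f : 𝔽₂ⁿ → 𝔽₂ be a Boolean function, with nonlinearity polynomial coefficients c : 𝔽₂^{n+1} → ℚ defined by c(0) = Σ_{u} F(u) and c(v) = (−2)^{w(v)} · Σ_{ṽ ⪯ u} (F(u) − 1/2) for v = (v₀, ṽ) ≠ 0, where F is the 0/1 integer lift of f. Then for every a ∈ {0,1}^{n+1} ⊂ ℚ^{n+1}, the evaluation Σ_{v ∈ 𝔽₂^{n+1}} c(v) · Π_{i=0}^{n} aᵢ^{vᵢ} is an integer with 0 ≤ Σ_{v} c(v) · Π_{i=0}^{n} aᵢ^{vᵢ} ≤ 2ⁿ. -/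
open Finset

open Classical in
/-- Summing signed monomials over the vectors supported in `{i | p i}` factors as a product. -/
theorem sum_neg_two_pow_wt_mul_prod {m : ℕ} (p : Fin m → Prop) (a : Fin m → ℚ) :
    ∑ v : Fin m → ZMod 2, (if ∀ i, v i = 1 → p i then
        (-2 : ℚ) ^ wt v * ∏ i, a i ^ (if v i = 1 then 1 else 0 : ℕ) else 0) =
      ∏ i, (if p i then 1 - 2 * a i else 1) := by
  have h : ∀ i, (if p i then 1 - 2 * a i else 1) =
      ∑ j : ZMod 2, if j = 1 then (if p i then -2 * a i else 0) else 1 := by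
    intro i
    have hz : (univ : Finset (ZMod 2)) = {0, 1} := rfl
    rw [hz, sum_pair (by decide)]
    by_cases hp : p i
    · simp [hp]
      ring
    · simp [hp]
  simp_rw [h]
  rw [prod_univ_sum, Fintype.piFinset_univ]
  refine sum_congr rfl fun v _ => ?_
  split_ifs with hv
  · rw [wt, ← prod_const, prod_filter, ← prod_mul_distrib]
    refine prod_congr rfl fun i _ => ?_
    by_cases hi : v i = 1
    · simp [hi, hv i hi]
    · simp [hi]
  · push Not at hv
    obtain ⟨i, hi, hp⟩ := hv
    exact (prod_eq_zero (mem_univ i) (by simp [hi, hp])).symm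

/-- A product of factors `±1` is `±1`. -/
theorem prod_eq_one_or_neg_one {ι R : Type*} [CommRing R] (s : Finset ι) (g : ι → R)
    (hg : ∀ i ∈ s, g i = 1 ∨ g i = -1) : ∏ i ∈ s, g i = 1 ∨ ∏ i ∈ s, g i = -1 := by
  refine prod_induction g (fun x => x = 1 ∨ x = -1) ?_ (Or.inl rfl) hg
  rintro x y (rfl | rfl) (rfl | rfl) <;> simp

/-- Every evaluation of the nonlinearity polynomial at a point of `{0,1}^{n+1}`
is an integer between `0` and `2ⁿ`. -/
theorem nlp_eval_int_and_bounds (n : ℕ) (f : (Fin n → ZMod 2) → ZMod 2)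
    (F : (Fin n → ZMod 2) → ℚ) (hF : ∀ x, F x = if f x = 1 then 1 else 0)
    (c : (Fin (n + 1) → ZMod 2) → ℚ)
    (hc0 : c 0 = ∑ u : Fin n → ZMod 2, F u)
    (hcv : ∀ v : Fin (n + 1) → ZMod 2, v ≠ 0 →
      c v = (-2 : ℚ) ^ wt v *
        ∑ u ∈ univ.filter (fun u : Fin n → ZMod 2 => ∀ i, v i.succ = 1 → u i = 1),
          (F u - 1 / 2))
    (a : Fin (n + 1) → ℚ) (ha : ∀ i, a i = 0 ∨ a i = 1) :
    (∃ m : ℤ, (∑ v : Fin (n + 1) → ZMod 2,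
        c v * ∏ i : Fin (n + 1), a i ^ (if v i = 1 then 1 else 0 : ℕ)) = m)
    ∧ 0 ≤ ∑ v : Fin (n + 1) → ZMod 2,
        c v * ∏ i : Fin (n + 1), a i ^ (if v i = 1 then 1 else 0 : ℕ)
    ∧ (∑ v : Fin (n + 1) → ZMod 2,
        c v * ∏ i : Fin (n + 1), a i ^ (if v i = 1 then 1 else 0 : ℕ)) ≤ 2 ^ n := by
  classical
  let s : (Fin n → ZMod 2) → ℚ := fun u =>
    ∏ i, (if (Fin.cases True (fun j => u j = 1) i : Prop) then 1 - 2 * a i else 1)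
  have hs : ∀ u, s u = 1 ∨ s u = -1 := by
    intro u
    refine prod_eq_one_or_neg_one _ _ fun i _ => ?_
    rcases ha i with h | h <;> rw [h] <;> split_ifs <;> norm_num
  have hc : ∀ v, c v = (if v = 0 then (2 : ℚ) ^ n / 2 else 0) + (-2 : ℚ) ^ wt v *
      ∑ u ∈ univ.filter (fun u : Fin n → ZMod 2 => ∀ i, v i.succ = 1 → u i = 1),
        (F u - 1 / 2) := by
    intro v
    by_cases hv : v = 0
    · subst hv
      simp [hc0, wt, div_eq_mul_inv]
    · simp [hcv v hv, hv]
  have key : ∑ v : Fin (n + 1) → ZMod 2,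
      c v * ∏ i : Fin (n + 1), a i ^ (if v i = 1 then 1 else 0 : ℕ) =
      ∑ u, (1 / 2 + (F u - 1 / 2) * s u) := by
    simp_rw [hc, add_mul, sum_add_distrib]
    congr 1
    · simp [ite_mul, div_eq_mul_inv]
    · simp_rw [s, ← sum_neg_two_pow_wt_mul_prod, mul_sum, sum_mul, sum_filter]
      rw [sum_comm]
      refine sum_congr rfl fun u _ => sum_congr rfl fun v _ => ?_
      simp only [Fin.forall_fin_succ (P := fun i => v i = 1 → _), Fin.cases_zero, Fin.cases_succ,
        implies_true, true_and]
      split_ifs <;> ring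
  have hterm : ∀ u, 1 / 2 + (F u - 1 / 2) * s u = 0 ∨ 1 / 2 + (F u - 1 / 2) * s u = 1 := by
    intro u
    rw [hF u]
    rcases hs u with h | h <;> rw [h] <;> split_ifs <;> norm_num
  rw [key]
  refine ⟨?_, ?_, ?_⟩
  · refine sum_induction _ (fun x : ℚ => ∃ m : ℤ, x = m) ?_ ⟨0, by simp⟩ fun u _ => ?_
    · rintro _ _ ⟨x, rfl⟩ ⟨y, rfl⟩
      exact ⟨x + y, by simp⟩
    · rcases hterm u with h | h
      · exact ⟨0, by rw [h]; simp⟩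
      · exact ⟨1, by rw [h]; simp⟩
  · refine sum_nonneg fun u _ => ?_
    rcases hterm u with h | h <;> linarith
  · calc _ ≤ ∑ _u : Fin n → ZMod 2, (1 : ℚ) := sum_le_sum fun u _ => by
          rcases hterm u with h | h <;> linarith
      _ = 2 ^ n := by simp
end
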